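/- (Lemma 3.3, existential content of Extend-Coloring.) Let G be a finite simple graph, χ a proper partial edge coloring of G with palette C of size μ ≥ 2, 𝒰 a separable collection of u-fans of size λ, and η ≥ 10 an integer. Then there exists a proper partial edge coloring χ′ of G with palette C whose set of uncolored edges is a subset of the set of uncolored edges of χ, and the number of uncolored edges of χ′ is at most (number of uncolored edges of χ) − λ · 100^{−((log μ / log η) + 1)}. -/

import Mathlib

open Classical

/-- A partial edge coloring `χ` of a graph `G` is *proper* if no two distinct edges of `G`
sharing a vertex receive the same color. -/
def Proper {V C : Type*} (G : SimpleGraph V) (χ : Sym2 V → Option C) : Prop :=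
  ∀ e₁ ∈ G.edgeSet, ∀ e₂ ∈ G.edgeSet, e₁ ≠ e₂ →
    (∃ x : V, x ∈ e₁ ∧ x ∈ e₂) → ∀ c : C, χ e₁ = some c → χ e₂ ≠ some c

/-- The set of uncolored edges of `G` under the partial coloring `χ`. -/
def uncolored {V C : Type*} (G : SimpleGraph V) (χ : Sym2 V → Option C) : Set (Sym2 V) :=
  {e | e ∈ G.edgeSet ∧ χ e = none}

/-- `missing G χ u` is the set of colors not assigned by `χ` to any edge of `G` incident on `u`. -/
def missing {V C : Type*} (G : SimpleGraph V) (χ : Sym2 V → Option C) (u : V) : Set C :=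
  {c | ∀ e ∈ G.edgeSet, u ∈ e → χ e ≠ some c}

/-- A u-fan: a center `u`, two leaves `v`, `w`, and assigned colors. -/
structure UFan (V : Type*) (C : Type*) where
  u : V
  v : V
  w : V
  cu : C
  cv : C
  cw : C

/-- The (uncolored) edges of a u-fan. -/
def UFan.edges {V C : Type*} (f : UFan V C) : Set (Sym2 V) := {s(f.u, f.v), s(f.u, f.w)}

/-- `f.assigns x c` means that `x` is a vertex of `f` and `c` is the color `c_f(x)`
 that `f` assigns to `x`. -/
def UFan.assigns {V C : Type*} (f : UFan V C) (x : V) (c : C) : Prop :=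
  (x = f.u ∧ c = f.cu) ∨ (x = f.v ∧ c = f.cv) ∨ (x = f.w ∧ c = f.cw)

/-- `f` is a u-fan with respect to the graph `G` and the proper partial coloring `χ`. -/
def IsUFan {V C : Type*} (G : SimpleGraph V) (χ : Sym2 V → Option C) (f : UFan V C) : Prop :=
  f.u ≠ f.v ∧ f.u ≠ f.w ∧ f.v ≠ f.w ∧
  s(f.u, f.v) ∈ uncolored G χ ∧ s(f.u, f.w) ∈ uncolored G χ ∧
  f.cu ∈ missing G χ f.u ∧ f.cv ∈ missing G χ f.v ∧ f.cw ∈ missing G χ f.w ∧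
  f.cu ≠ f.cv ∧ f.cv = f.cw

/-- A collection of u-fans is separable if the u-fans are pairwise edge-disjoint and,
for each vertex `x`, the colors assigned to `x` by the u-fans containing `x` are
pairwise distinct. -/
def Separable {V C : Type*} (𝒰 : Finset (UFan V C)) : Prop :=
  (∀ f ∈ 𝒰, ∀ g ∈ 𝒰, f ≠ g → Disjoint f.edges g.edges) ∧
  (∀ f ∈ 𝒰, ∀ g ∈ 𝒰, f ≠ g → ∀ (x : V) (c : C), f.assigns x c → ¬ g.assigns x c)

/-- A graph of maximum degree at most two has at most two vertices of degree at most one in each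
connected component. -/
theorem SimpleGraph.ConnectedComponent.card_degree_le_one_le_two {V : Type*} [Fintype V]
    {H : SimpleGraph V} (hdeg : ∀ x, H.degree x ≤ 2) (K : H.ConnectedComponent)
    (D : Finset V) (hDK : ∀ x ∈ D, x ∈ K) (hD : ∀ x ∈ D, H.degree x ≤ 1) : D.card ≤ 2 := by
  have hcard := (K.connected_toSimpleGraph).card_vert_le_card_edgeSet_add_one
  have hsum := K.toSimpleGraph.sum_degrees_eq_twice_card_edges
  rw [Nat.card_eq_fintype_card, Nat.card_eq_fintype_card,
    ← SimpleGraph.edgeFinset_card] at hcard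
  have hle : ∀ x : K, K.toSimpleGraph.degree x + (if x.1 ∈ D then 1 else 0) ≤ 2 := by
    intro x
    have hx : K.toSimpleGraph.degree x ≤ H.degree x.1 := by
      rw [← SimpleGraph.card_neighborFinset_eq_degree, ← SimpleGraph.card_neighborFinset_eq_degree]
      refine Finset.card_le_card_of_injOn (fun y => y.1) ?_ (fun a _ b _ h => Subtype.ext h)
      intro y hy
      have hxy : K.toSimpleGraph.Adj x y := by
        rwa [Finset.mem_coe, SimpleGraph.mem_neighborFinset] at hy
      rw [Finset.mem_coe, SimpleGraph.mem_neighborFinset]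
      exact hxy
    split_ifs with h
    · have := hD _ h
      omega
    · have := hdeg x.1
      omega
  have hle_sum := Finset.sum_le_sum (fun x (_ : x ∈ (Finset.univ : Finset K)) => hle x)
  have hcardD : D.card ≤ ∑ x : K, (if x.1 ∈ D then 1 else 0) := by
    rw [← Finset.card_filter]
    refine Finset.card_le_card_of_surjOn (fun y : K => y.1) ?_
    intro x hx
    exact ⟨⟨x, hDK x hx⟩, by simpa using hx, rfl⟩
  rw [Finset.sum_add_distrib, hsum] at hle_sum
  simp only [Finset.sum_const, Finset.card_univ, smul_eq_mul] at hle_sum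
  omega

section Kempe

variable {V C : Type*} {G : SimpleGraph V} {χ : Sym2 V → Option C} {α β : C} {K : Set V}

/-- The subgraph of edges colored `α` or `β`. -/
def kempeGraph (G : SimpleGraph V) (χ : Sym2 V → Option C) (α β : C) : SimpleGraph V where
  Adj x y := G.Adj x y ∧ (χ s(x, y) = some α ∨ χ s(x, y) = some β)
  symm := ⟨fun x y h => by rw [Sym2.eq_swap]; exact ⟨h.1.symm, h.2⟩⟩
  loopless := ⟨fun x h => h.1.ne rfl⟩

theorem Proper.eq_of_adj (hχ : Proper G χ) {x y z : V} (hy : G.Adj x y) (hz : G.Adj x z) {c : C}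
    (hcy : χ s(x, y) = some c) (hcz : χ s(x, z) = some c) : y = z := by
  by_contra hne
  exact hχ s(x, y) hy s(x, z) hz (by rwa [ne_eq, Sym2.congr_right]) ⟨x, by simp, by simp⟩ c hcy hcz

theorem degree_kempeGraph_le_card [Fintype V] (hχ : Proper G χ) (x : V) (S : Finset C)
    (hS : ∀ y, G.Adj x y → ∀ c, χ s(x, y) = some c → c = α ∨ c = β → c ∈ S) :
    (kempeGraph G χ α β).degree x ≤ S.card := by
  rw [← SimpleGraph.card_neighborFinset_eq_degree, ← Finset.card_map (s := S) Function.Embedding.some]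
  refine Finset.card_le_card_of_injOn (fun y => χ s(x, y)) ?_ ?_
  · intro y hy
    have hy' : (kempeGraph G χ α β).Adj x y := by simpa using hy
    simp only [Finset.coe_map, Function.Embedding.some_apply, Set.mem_image, Finset.mem_coe]
    rcases hy'.2 with h | h
    · exact ⟨α, hS y hy'.1 α h (.inl rfl), h.symm⟩
    · exact ⟨β, hS y hy'.1 β h (.inr rfl), h.symm⟩
  · intro y hy z hz hyz
    have hy' : (kempeGraph G χ α β).Adj x y := by simpa using hy
    have hz' : (kempeGraph G χ α β).Adj x z := by simpa using hz
    simp only at hyz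
    rcases hy'.2 with h | h
    · exact hχ.eq_of_adj hy'.1 hz'.1 h (hyz ▸ h)
    · exact hχ.eq_of_adj hy'.1 hz'.1 h (hyz ▸ h)

theorem degree_kempeGraph_le_two [Fintype V] (hχ : Proper G χ) (x : V) :
    (kempeGraph G χ α β).degree x ≤ 2 :=
  (degree_kempeGraph_le_card hχ x {α, β} (by simp)).trans Finset.card_le_two

theorem degree_kempeGraph_le_one [Fintype V] (hχ : Proper G χ) {x : V}
    (hx : α ∈ missing G χ x ∨ β ∈ missing G χ x) : (kempeGraph G χ α β).degree x ≤ 1 := by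
  rcases hx with hx | hx
  · refine (degree_kempeGraph_le_card hχ x {β} ?_).trans (by simp)
    rintro y hy c hc (rfl | rfl)
    · exact absurd hc (hx _ hy (by simp))
    · simp
  · refine (degree_kempeGraph_le_card hχ x {α} ?_).trans (by simp)
    rintro y hy c hc (rfl | rfl)
    · simp
    · exact absurd hc (hx _ hy (by simp))

/-- Exchange the colors `α` and `β` on all edges touching `K`. -/
noncomputable def kempeFlip (χ : Sym2 V → Option C) (α β : C) (K : Set V) (e : Sym2 V) :
    Option C :=
  if ∃ x ∈ e, x ∈ K then (χ e).map (Equiv.swap α β) else χ e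

theorem kempeFlip_eq_none {e : Sym2 V} : kempeFlip χ α β K e = none ↔ χ e = none := by
  unfold kempeFlip
  split_ifs <;> simp

theorem kempeFlip_apply (hK : ∀ x y, (kempeGraph G χ α β).Adj x y → x ∈ K → y ∈ K)
    {e : Sym2 V} (he : e ∈ G.edgeSet) {x : V} (hx : x ∈ e) :
    kempeFlip χ α β K e = if x ∈ K then (χ e).map (Equiv.swap α β) else χ e := by
  by_cases hxK : x ∈ K
  · rw [kempeFlip, if_pos ⟨x, hx, hxK⟩, if_pos hxK]
  rw [if_neg hxK, kempeFlip]
  split_ifs with h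
  swap
  · rfl
  obtain ⟨y, hy, hyK⟩ := h
  have hyx : y ≠ x := by
    rintro rfl
    exact hxK hyK
  obtain rfl : e = s(y, x) := ((Sym2.mem_and_mem_iff hyx).1 ⟨hy, hx⟩)
  cases hc : χ s(y, x) with
  | none => rfl
  | some c =>
    have hcα : c ≠ α := by
      rintro rfl
      exact hxK (hK y x ⟨he, .inl hc⟩ hyK)
    have hcβ : c ≠ β := by
      rintro rfl
      exact hxK (hK y x ⟨he, .inr hc⟩ hyK)
    simp [Equiv.swap_apply_of_ne_of_ne hcα hcβ]

theorem Proper.kempeFlip (hχ : Proper G χ)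
    (hK : ∀ x y, (kempeGraph G χ α β).Adj x y → x ∈ K → y ∈ K) :
    Proper G (kempeFlip χ α β K) := by
  rintro e₁ he₁ e₂ he₂ hne ⟨x, hx₁, hx₂⟩ c h₁ h₂
  rw [kempeFlip_apply hK he₁ hx₁] at h₁
  rw [kempeFlip_apply hK he₂ hx₂] at h₂
  split_ifs at h₁ h₂ with hx
  · obtain ⟨a, ha, hac⟩ := Option.map_eq_some_iff.1 h₁
    obtain ⟨b, hb, hbc⟩ := Option.map_eq_some_iff.1 h₂
    obtain rfl := (Equiv.swap α β).injective (hac.trans hbc.symm)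
    exact hχ e₁ he₁ e₂ he₂ hne ⟨x, hx₁, hx₂⟩ a ha hb
  · exact hχ e₁ he₁ e₂ he₂ hne ⟨x, hx₁, hx₂⟩ c h₁ h₂

theorem mem_missing_kempeFlip_of_notMem
    (hK : ∀ x y, (kempeGraph G χ α β).Adj x y → x ∈ K → y ∈ K) {x : V} (hx : x ∉ K) {c : C} :
    c ∈ missing G (kempeFlip χ α β K) x ↔ c ∈ missing G χ x := by
  refine forall₃_congr fun e he hxe => ?_
  rw [kempeFlip_apply hK he hxe, if_neg hx]

theorem mem_missing_kempeFlip_of_mem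
    (hK : ∀ x y, (kempeGraph G χ α β).Adj x y → x ∈ K → y ∈ K) {x : V} (hx : x ∈ K) {c : C} :
    c ∈ missing G (kempeFlip χ α β K) x ↔ Equiv.swap α β c ∈ missing G χ x := by
  refine forall₃_congr fun e he hxe => ?_
  rw [kempeFlip_apply hK he hxe, if_pos hx, not_iff_not, Option.map_eq_some_iff]
  constructor
  · rintro ⟨a, ha, rfl⟩
    simpa using ha
  · exact fun h => ⟨_, h, by simp⟩

theorem Proper.update (hχ : Proper G χ) {u z : V} (hu : α ∈ missing G χ u)
    (hz : α ∈ missing G χ z) : Proper G (Function.update χ s(u, z) (some α)) := by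
  have key : ∀ e ∈ G.edgeSet, (∃ x, x ∈ s(u, z) ∧ x ∈ e) → χ e ≠ some α := by
    rintro e he ⟨x, hx, hxe⟩
    rcases Sym2.mem_iff.1 hx with rfl | rfl
    · exact hu e he hxe
    · exact hz e he hxe
  rintro e₁ he₁ e₂ he₂ hne ⟨x, hx₁, hx₂⟩ c h₁ h₂
  rw [Function.update_apply] at h₁ h₂
  split_ifs at h₁ h₂ with h h' h'
  · exact hne (h.trans h'.symm)
  · cases h₁
    exact key e₂ he₂ ⟨x, h ▸ hx₁, hx₂⟩ h₂
  · cases h₂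
    exact key e₁ he₁ ⟨x, h' ▸ hx₂, hx₁⟩ h₁
  · exact hχ e₁ he₁ e₂ he₂ hne ⟨x, hx₁, hx₂⟩ c h₁ h₂

theorem mem_missing_update {u z x : V} {c : C} (hc : c ∈ missing G χ x)
    (hu : ¬ (x = u ∧ c = α)) (hz : ¬ (x = z ∧ c = α)) :
    c ∈ missing G (Function.update χ s(u, z) (some α)) x := by
  intro e he hxe h
  rw [Function.update_apply] at h
  split_ifs at h with h'
  · cases h
    subst h'
    rcases Sym2.mem_iff.1 hxe with rfl | rfl
    · exact hu ⟨rfl, rfl⟩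
    · exact hz ⟨rfl, rfl⟩
  · exact hc e he hxe h

end Kempe

section Fans

variable {V C : Type*} {G : SimpleGraph V} {χ χ' : Sym2 V → Option C} {f : UFan V C}
  {𝒰 𝒱 : Finset (UFan V C)}

theorem IsUFan.mem_missing (hf : IsUFan G χ f) {x : V} {c : C} (h : f.assigns x c) :
    c ∈ missing G χ x := by
  obtain ⟨-, -, -, -, -, hu, hv, hw, -, -⟩ := hf
  rcases h with ⟨rfl, rfl⟩ | ⟨rfl, rfl⟩ | ⟨rfl, rfl⟩ <;> assumption

theorem IsUFan.of_preserved (hf : IsUFan G χ f)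
    (hedge : ∀ e ∈ f.edges, χ e = none → χ' e = none)
    (hmiss : ∀ x c, f.assigns x c → c ∈ missing G χ' x) : IsUFan G χ' f := by
  obtain ⟨h₁, h₂, h₃, h₄, h₅, -, -, -, h₆, h₇⟩ := hf
  exact ⟨h₁, h₂, h₃, ⟨h₄.1, hedge _ (.inl rfl) h₄.2⟩, ⟨h₅.1, hedge _ (.inr rfl) h₅.2⟩,
    hmiss _ _ (.inl ⟨rfl, rfl⟩), hmiss _ _ (.inr (.inl ⟨rfl, rfl⟩)),
    hmiss _ _ (.inr (.inr ⟨rfl, rfl⟩)), h₆, h₇⟩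

theorem Separable.mono (h : Separable 𝒰) (hsub : 𝒱 ⊆ 𝒰) : Separable 𝒱 :=
  ⟨fun f hf g hg => h.1 f (hsub hf) g (hsub hg), fun f hf g hg => h.2 f (hsub hf) g (hsub hg)⟩

theorem Separable.card_filter_assigns_le (h : Separable 𝒰) (S : Finset (V × C)) :
    (𝒰.filter fun g => ∃ p ∈ S, g.assigns p.1 p.2).card ≤ S.card := by
  refine Finset.card_le_card_of_forall_subsingleton (fun g p => g.assigns p.1 p.2) ?_ ?_
  · intro g hg
    exact (Finset.mem_filter.1 hg).2
  · rintro p - g ⟨hg, hgp⟩ g' ⟨hg', hgp'⟩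
    by_contra hne
    exact h.2 g (Finset.mem_filter.1 hg).1 g' (Finset.mem_filter.1 hg').1 hne _ _ hgp hgp'

/-- In a u-fan, one of the leaves is not joined to the center by an alternating path. -/
theorem IsUFan.exists_leaf [Fintype V] (hχ : Proper G χ) (hf : IsUFan G χ f) :
    ∃ z, s(f.u, z) ∈ f.edges ∧ f.assigns z f.cv ∧
      ¬ (kempeGraph G χ f.cu f.cv).Reachable z f.u := by
  by_contra! hcon
  have hv := hcon f.v (.inl rfl) (.inr (.inl ⟨rfl, rfl⟩))
  have hw := hcon f.w (.inr rfl) (.inr (.inr ⟨rfl, hf.2.2.2.2.2.2.2.2.2⟩))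
  obtain ⟨huv, huw, hvw, -, -, hmu, hmv, hmw, -, hc⟩ := hf
  have := SimpleGraph.ConnectedComponent.card_degree_le_one_le_two
    (degree_kempeGraph_le_two hχ) ((kempeGraph G χ f.cu f.cv).connectedComponentMk f.u)
    {f.u, f.v, f.w} (by
      simp only [Finset.mem_insert, Finset.mem_singleton]
      rintro x (rfl | rfl | rfl)
      · rfl
      · exact SimpleGraph.ConnectedComponent.sound hv
      · exact SimpleGraph.ConnectedComponent.sound hw) (by
      simp only [Finset.mem_insert, Finset.mem_singleton]
      rintro x (rfl | rfl | rfl)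
      · exact degree_kempeGraph_le_one hχ (.inl hmu)
      · exact degree_kempeGraph_le_one hχ (.inr hmv)
      · exact degree_kempeGraph_le_one hχ (.inr (hc ▸ hmw)))
  rw [Finset.card_eq_three.2 ⟨f.u, f.v, f.w, huv, huw, hvw, rfl⟩] at this
  omega

/-- Activating a u-fan colors an edge and damages at most four u-fans, including itself. -/
theorem exists_activate [Fintype V] (hχ : Proper G χ) (h𝒰 : ∀ g ∈ 𝒰, IsUFan G χ g)
    (hsep : Separable 𝒰) (hf : f ∈ 𝒰) :
    ∃ (χ' : Sym2 V → Option C) (𝒱 : Finset (UFan V C)), Proper G χ' ∧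
      uncolored G χ' ⊂ uncolored G χ ∧ 𝒱 ⊂ 𝒰 ∧ 𝒰.card ≤ 𝒱.card + 4 ∧
      ∀ g ∈ 𝒱, IsUFan G χ' g := by
  obtain ⟨z, hze, hzc, hz⟩ := (h𝒰 f hf).exists_leaf hχ
  set α := f.cu
  set β := f.cv
  set H := kempeGraph G χ α β
  set K : Set V := {x | H.Reachable z x}
  have hK : ∀ x y, H.Adj x y → x ∈ K → y ∈ K := fun x y hxy hx => hx.trans hxy.reachable
  have hzK : z ∈ K := SimpleGraph.Reachable.refl z
  have huK : f.u ∉ K := hz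
  have huncol : s(f.u, z) ∈ uncolored G χ := by
    rcases hze with h | h
    · exact h ▸ (h𝒰 f hf).2.2.2.1
    · exact h ▸ (h𝒰 f hf).2.2.2.2.1
  have huα : f.assigns f.u α := .inl ⟨rfl, rfl⟩
  have hzβ : β ∈ missing G χ z := (h𝒰 f hf).mem_missing hzc
  let D : Finset V := Finset.univ.filter fun x =>
    x ∈ K ∧ (α ∈ missing G χ x ∨ β ∈ missing G χ x)
  have hD : D.card ≤ 2 := by
    refine SimpleGraph.ConnectedComponent.card_degree_le_one_le_two
      (degree_kempeGraph_le_two hχ) (H.connectedComponentMk z) D ?_ ?_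
    · intro x hx
      exact SimpleGraph.ConnectedComponent.sound (Finset.mem_filter.1 hx).2.1.symm
    · intro x hx
      exact degree_kempeGraph_le_one hχ (Finset.mem_filter.1 hx).2.2
  have hzD : z ∈ D := Finset.mem_filter.2 ⟨Finset.mem_univ _, hzK, .inr hzβ⟩
  let S : Finset (V × C) := D ×ˢ {α, β}
  have hS : S.card ≤ 4 := by
    have h₂ : ({α, β} : Finset C).card ≤ 2 := Finset.card_le_two
    rw [Finset.card_product]
    exact Nat.mul_le_mul hD h₂
  have hbad := (hsep.card_filter_assigns_le S).trans hS
  have hsplit := Finset.card_filter_add_card_filter_not (s := 𝒰)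
    (fun g => ∃ p ∈ S, g.assigns p.1 p.2)
  have huα' : α ∈ missing G (kempeFlip χ α β K) f.u :=
    (mem_missing_kempeFlip_of_notMem hK huK).2 ((h𝒰 f hf).mem_missing huα)
  have hzα' : α ∈ missing G (kempeFlip χ α β K) z :=
    (mem_missing_kempeFlip_of_mem hK hzK).2 (by simpa using hzβ)
  have hfS : ∃ p ∈ S, f.assigns p.1 p.2 := ⟨(z, β), by simp [S, hzD], hzc⟩
  refine ⟨Function.update (kempeFlip χ α β K) s(f.u, z) (some α),
    𝒰.filter fun g => ¬ ∃ p ∈ S, g.assigns p.1 p.2, (hχ.kempeFlip hK).update huα' hzα', ?_,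
    Finset.filter_ssubset.2 ⟨f, hf, not_not.2 hfS⟩, by omega, ?_⟩
  · refine (Set.ssubset_iff_of_subset ?_).2 ⟨_, huncol, fun h => by simpa using h.2⟩
    rintro e ⟨he, h⟩
    rw [Function.update_apply] at h
    split_ifs at h
    exact ⟨he, kempeFlip_eq_none.1 h⟩
  · intro g hg
    obtain ⟨hg𝒰, hgS⟩ := Finset.mem_filter.1 hg
    have hne : f ≠ g := by
      rintro rfl
      exact hgS hfS
    refine (h𝒰 g hg𝒰).of_preserved ?_ ?_
    · intro e he h
      rw [Function.update_of_ne, kempeFlip_eq_none]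
      · exact h
      · rintro rfl
        exact Set.disjoint_left.1 (hsep.1 f hf g hg𝒰 hne) hze he
    · intro x c hxc
      have hmiss := (h𝒰 g hg𝒰).mem_missing hxc
      refine mem_missing_update ?_ ?_ ?_
      · by_cases hx : x ∈ K
        · rw [mem_missing_kempeFlip_of_mem hK hx, Equiv.swap_apply_of_ne_of_ne]
          · exact hmiss
          · rintro rfl
            exact hgS ⟨(x, α), by simp [S, D, hx, hmiss], hxc⟩
          · rintro rfl
            exact hgS ⟨(x, β), by simp [S, D, hx, hmiss], hxc⟩
        · exact (mem_missing_kempeFlip_of_notMem hK hx).2 hmiss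
      · rintro ⟨rfl, rfl⟩
        exact hsep.2 f hf g hg𝒰 hne _ _ huα hxc
      · rintro ⟨rfl, rfl⟩
        exact hgS ⟨(x, α), by simp [S, hzD], hxc⟩

/-- A separable collection of u-fans allows coloring at least a quarter as many edges. -/
theorem exists_extension_of_separable [Fintype V] (hχ : Proper G χ)
    (h𝒰 : ∀ g ∈ 𝒰, IsUFan G χ g) (hsep : Separable 𝒰) :
    ∃ χ' : Sym2 V → Option C, Proper G χ' ∧ uncolored G χ' ⊆ uncolored G χ ∧
      4 * (uncolored G χ').ncard + 𝒰.card ≤ 4 * (uncolored G χ).ncard := by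
  induction 𝒰 using Finset.strongInduction generalizing χ with
  | H 𝒰 ih =>
    rcases 𝒰.eq_empty_or_nonempty with rfl | ⟨f, hf⟩
    · exact ⟨χ, hχ, subset_rfl, by simp⟩
    obtain ⟨χ₁, 𝒱, hχ₁, hsub₁, hsub, hcard, h𝒱⟩ := exists_activate hχ h𝒰 hsep hf
    obtain ⟨χ₂, hχ₂, hsub₂, hcard₂⟩ := ih 𝒱 hsub hχ₁ h𝒱 (hsep.mono hsub.subset)
    have := Set.ncard_lt_ncard hsub₁ (Set.toFinite _)
    exact ⟨χ₂, hχ₂, hsub₂.trans hsub₁.subset, by omega⟩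

end Fans

/-- **Lemma 3.3 (existential content of Extend-Coloring).** -/
theorem extend_coloring_exists
    {V C : Type*} [Fintype V] [Fintype C]
    (G : SimpleGraph V) (χ : Sym2 V → Option C) (hproper : Proper G χ)
    (𝒰 : Finset (UFan V C)) (h𝒰 : ∀ f ∈ 𝒰, IsUFan G χ f) (hsep : Separable 𝒰)
    (hμ : 2 ≤ Fintype.card C) (η : ℕ) (hη : 10 ≤ η) :
    ∃ χ' : Sym2 V → Option C,
      Proper G χ' ∧ uncolored G χ' ⊆ uncolored G χ ∧
      ((uncolored G χ').ncard : ℝ) ≤ ((uncolored G χ).ncard : ℝ) -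
        (𝒰.card : ℝ) *
          (100 : ℝ) ^ (-(Real.log (Fintype.card C) / Real.log η + 1)) := by
  obtain ⟨χ', hχ', hsub, hcard⟩ := exists_extension_of_separable hproper h𝒰 hsep
  refine ⟨χ', hχ', hsub, ?_⟩
  have hlog : 0 ≤ Real.log (Fintype.card C) / Real.log η :=
    div_nonneg (Real.log_natCast_nonneg _) (Real.log_natCast_nonneg _)
  have hpow : (100 : ℝ) ^ (-(Real.log (Fintype.card C) / Real.log η + 1)) ≤ 1 / 4 :=
    calc (100 : ℝ) ^ (-(Real.log (Fintype.card C) / Real.log η + 1)) ≤ (100 : ℝ) ^ (-1 : ℝ) :=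
          Real.rpow_le_rpow_of_exponent_le (by norm_num) (by linarith)
      _ ≤ 1 / 4 := by rw [Real.rpow_neg_one]; norm_num
  have hmul := mul_le_mul_of_nonneg_left hpow (Nat.cast_nonneg (α := ℝ) 𝒰.card)
  have hcard' : 4 * ((uncolored G χ').ncard : ℝ) + 𝒰.card ≤ 4 * (uncolored G χ).ncard := by
    exact_mod_cast hcard
  linarith
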